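/- arXiv:2409.07402 — 3 statements merged into one kernel-verified Lean document; each statement's English description precedes it below -/
import Mathlib

section
/- Let X1, X2, Y be random variables taking values in finite sets on a probability space, and let R, S, U1, U2 be nonnegative real numbers satisfying the Partial Information Decomposition consistency equations I(⟨X1,X2⟩ : Y) = R + S + U1 + U2, I(X1 : Y) = R + U1, and I(X2 : Y) = R + U2, where I denotes Shannon mutual information. If for some ε > 0 the multiview-redundancy condition holds, i.e. the conditional mutual informations satisfy I(Y : X1 | X2) < ε and I(Y : X2 | X1) < ε, then 0 ≤ I(⟨X1,X2⟩ : Y) − R < 2ε; in other words, under multiview redundancy the total task-relevant multimodal information is, up to 2ε, exactly the redundant information R. -/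
open MeasureTheory ProbabilityTheory Real

/-- Shannon entropy of a finitely-valued random variable `X` under `μ`. -/
noncomputable def shEntropy {Ω α : Type*} [MeasurableSpace Ω] [Fintype α]
    (μ : Measure Ω) (X : Ω → α) : ℝ :=
  -∑ a : α, (μ (X ⁻¹' {a})).toReal * Real.log (μ (X ⁻¹' {a})).toReal

/-- Shannon mutual information `I(X : Y) = H(X) + H(Y) - H(⟨X,Y⟩)`. -/
noncomputable def mutInfo {Ω α β : Type*} [MeasurableSpace Ω] [Fintype α] [Fintype β]
    (μ : Measure Ω) (X : Ω → α) (Y : Ω → β) : ℝ :=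
  shEntropy μ X + shEntropy μ Y - shEntropy μ (fun ω => (X ω, Y ω))

/-- Conditional mutual information
`I(X : Y | Z) = H(⟨X,Z⟩) + H(⟨Y,Z⟩) - H(Z) - H(⟨X,Y,Z⟩)`. -/
noncomputable def condMutInfo {Ω α β γ : Type*} [MeasurableSpace Ω]
    [Fintype α] [Fintype β] [Fintype γ]
    (μ : Measure Ω) (X : Ω → α) (Y : Ω → β) (Z : Ω → γ) : ℝ :=
  shEntropy μ (fun ω => (X ω, Z ω)) + shEntropy μ (fun ω => (Y ω, Z ω))
    - shEntropy μ Z - shEntropy μ (fun ω => (X ω, Y ω, Z ω))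

/-- Shannon entropy is invariant under relabelling of the values. -/
theorem shEntropy_equiv_comp {Ω α β : Type*} [MeasurableSpace Ω] [Fintype α] [Fintype β]
    (μ : Measure Ω) (X : Ω → α) (e : α ≃ β) :
    shEntropy μ (fun ω => e (X ω)) = shEntropy μ X := by
  have h (a : α) : (fun ω => e (X ω)) ⁻¹' {e a} = X ⁻¹' {a} := by
    ext ω
    simp
  unfold shEntropy
  rw [← e.sum_comp]
  simp only [h]

/-- Chain rule: `I(⟨X,Z⟩ : Y) = I(Z : Y) + I(Y : X | Z)`. -/
theorem mutInfo_prodMk_eq_add_condMutInfo {Ω α β γ : Type*} [MeasurableSpace Ω]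
    [Fintype α] [Fintype β] [Fintype γ]
    (μ : Measure Ω) (X : Ω → α) (Z : Ω → β) (Y : Ω → γ) :
    mutInfo μ (fun ω => (X ω, Z ω)) Y = mutInfo μ Z Y + condMutInfo μ Y X Z := by
  have h := shEntropy_equiv_comp μ (fun ω => ((X ω, Z ω), Y ω)) (Equiv.prodComm (α × β) γ)
  have h' := shEntropy_equiv_comp μ (fun ω => (Z ω, Y ω)) (Equiv.prodComm β γ)
  simp only [Equiv.prodComm_apply, Prod.swap_prod_mk] at h h'
  unfold mutInfo condMutInfo
  linarith

/-- Mutual information is symmetric in the two components of its first argument. -/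
theorem mutInfo_prodMk_comm {Ω α β γ : Type*} [MeasurableSpace Ω]
    [Fintype α] [Fintype β] [Fintype γ]
    (μ : Measure Ω) (X : Ω → α) (Z : Ω → β) (Y : Ω → γ) :
    mutInfo μ (fun ω => (Z ω, X ω)) Y = mutInfo μ (fun ω => (X ω, Z ω)) Y := by
  have h := shEntropy_equiv_comp μ (fun ω => (X ω, Z ω)) (Equiv.prodComm α β)
  have h' := shEntropy_equiv_comp μ (fun ω => ((X ω, Z ω), Y ω))
    ((Equiv.prodComm α β).prodCongr (Equiv.refl γ))
  simp only [Equiv.prodComm_apply, Prod.swap_prod_mk, Equiv.prodCongr_apply, Prod.map_apply,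
    Equiv.refl_apply] at h h'
  unfold mutInfo
  linarith

/-- Under the multiview redundancy assumption, the total task-relevant multimodal
information is, up to `2ε`, exactly the redundant information `R`. -/
theorem multiview_redundancy_total_info_close_to_R
    {Ω α β γ : Type*} [MeasurableSpace Ω]
    [Fintype α] [MeasurableSpace α] [MeasurableSingletonClass α]
    [Fintype β] [MeasurableSpace β] [MeasurableSingletonClass β]
    [Fintype γ] [MeasurableSpace γ] [MeasurableSingletonClass γ]
    (μ : Measure Ω) [IsProbabilityMeasure μ]
    (X1 : Ω → α) (X2 : Ω → β) (Y : Ω → γ)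
    (hX1 : Measurable X1) (hX2 : Measurable X2) (hY : Measurable Y)
    (R S U1 U2 : ℝ) (hR : 0 ≤ R) (hS : 0 ≤ S) (hU1 : 0 ≤ U1) (hU2 : 0 ≤ U2)
    (hPID : mutInfo μ (fun ω => (X1 ω, X2 ω)) Y = R + S + U1 + U2)
    (h1 : mutInfo μ X1 Y = R + U1)
    (h2 : mutInfo μ X2 Y = R + U2)
    (ε : ℝ) (hε : 0 < ε)
    (hc1 : condMutInfo μ Y X1 X2 < ε)
    (hc2 : condMutInfo μ Y X2 X1 < ε) :
    0 ≤ mutInfo μ (fun ω => (X1 ω, X2 ω)) Y - R ∧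
      mutInfo μ (fun ω => (X1 ω, X2 ω)) Y - R < 2 * ε := by
  have hchain1 := mutInfo_prodMk_eq_add_condMutInfo μ X1 X2 Y
  have hchain2 := mutInfo_prodMk_eq_add_condMutInfo μ X2 X1 Y
  rw [mutInfo_prodMk_comm] at hchain2
  constructor <;> linarith
end

section
/- Sufficiency lemma: let X, X', Y, Z' be random variables taking values in finite sets on a probability space such that Z' = f ∘ X' for some function f, I(X' : Y | X) = 0 (i.e. Y → X → X' is a Markov chain), and I(Z' : X) = I(X' : X) (i.e. Z' retains all the information X' carries about X). Then I(Z' : Y) = I(X' : Y). -/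
open MeasureTheory ProbabilityTheory Real

section Entropy

variable {Ω α β γ : Type*} [MeasurableSpace Ω] {μ : Measure Ω} [IsFiniteMeasure μ]
  [Fintype α] [MeasurableSpace α] [MeasurableSingletonClass α]
  [Fintype β]

/-- Entropy of a function of `X`, written as a sum over the values of `X`. -/
lemma shEntropy_comp {X : Ω → α} (hX : Measurable X) (g : α → β) :
    shEntropy μ (fun ω => g (X ω)) =
      -∑ x, μ.real (X ⁻¹' {x}) * log (μ.real ((fun ω => g (X ω)) ⁻¹' {g x})) := by
  classical
  have marginal (b : β) : μ.real ((fun ω => g (X ω)) ⁻¹' {b}) =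
      ∑ x with g x = b, μ.real (X ⁻¹' {x}) := by
    rw [sum_measureReal_preimage_singleton _ fun x _ => hX (measurableSet_singleton x)]
    congr 1
    ext ω
    simp
  rw [shEntropy, ← Finset.sum_fiberwise Finset.univ g]
  congr 1
  refine Finset.sum_congr rfl fun b _ => ?_
  change μ.real _ * log (μ.real _) = _
  conv_lhs => enter [1]; rw [marginal b]
  rw [Finset.sum_mul]
  refine Finset.sum_congr rfl fun x hx => ?_
  rw [(Finset.mem_filter.1 hx).2]

lemma shEntropy_comp_of_injective {X : Ω → α} (hX : Measurable X) {g : α → β}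
    (hg : Function.Injective g) :
    shEntropy μ (fun ω => g (X ω)) = shEntropy μ X := by
  rw [shEntropy_comp hX g]
  have preimage_eq (x : α) : (fun ω => g (X ω)) ⁻¹' {g x} = X ⁻¹' {x} := by
    ext ω
    simp [hg.eq_iff]
  simp only [preimage_eq]
  rfl

variable [MeasurableSpace β] [MeasurableSingletonClass β]
  [MeasurableSpace γ] [MeasurableSingletonClass γ]

lemma sum_measureReal_prodMk_preimage_singleton {A : Ω → α} {C : Ω → γ}
    (hA : Measurable A) (hC : Measurable C) (c : γ) :
    ∑ a, μ.real ((fun ω => (A ω, C ω)) ⁻¹' {(a, c)}) = μ.real (C ⁻¹' {c}) := by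
  have h := sum_measureReal_preimage_singleton (μ := μ) (f := fun ω => (A ω, C ω))
    (Finset.univ ×ˢ {c}) fun y _ => (hA.prodMk hC) (measurableSet_singleton y)
  rw [Finset.sum_product] at h
  simp only [Finset.sum_singleton] at h
  rw [h]
  congr 1
  ext ω
  simp [eq_comm]

lemma sub_le_mul_log_sub_log {p q r s : ℝ} (hp : 0 ≤ p) (hpq : p ≤ q) (hpr : p ≤ r)
    (hqs : q ≤ s) :
    p - q * r / s ≤ p * (log p + log s - log q - log r) := by
  rcases hp.eq_or_lt with rfl | hp
  · have : 0 ≤ q * r / s := div_nonneg (mul_nonneg hpq hpr) (hpq.trans hqs)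
    simpa using this
  have hq : 0 < q := hp.trans_le hpq
  have hr : 0 < r := hp.trans_le hpr
  have hs : 0 < s := hq.trans_le hqs
  have hlog := log_le_sub_one_of_pos (show 0 < q * r / (s * p) by positivity)
  rw [log_div (by positivity) (by positivity), log_mul hq.ne' hr.ne',
    log_mul hs.ne' hp.ne'] at hlog
  have h := mul_le_mul_of_nonneg_left hlog hp.le
  have hcancel : p * (q * r / (s * p) - 1) = q * r / s - p := by field_simp
  rw [hcancel] at h
  linarith

/-- Submodularity of entropy. -/
lemma condMutInfo_nonneg [Fintype γ] {A : Ω → α} {B : Ω → β} {C : Ω → γ}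
    (hA : Measurable A) (hB : Measurable B) (hC : Measurable C) :
    0 ≤ condMutInfo μ A B C := by
  have hT : Measurable fun ω => (A ω, B ω, C ω) := hA.prodMk (hB.prodMk hC)
  have hAC := shEntropy_comp (μ := μ) hT fun x => (x.1, x.2.2)
  have hBC := shEntropy_comp (μ := μ) hT fun x => x.2
  have hCC := shEntropy_comp (μ := μ) hT fun x => x.2.2
  have hABC := shEntropy_comp (μ := μ) hT id
  simp only [id] at hAC hBC hCC hABC
  rw [condMutInfo, hAC, hBC, hCC, hABC]
  have hsum : ∑ x : α × β × γ, μ.real ((fun ω => (A ω, B ω, C ω)) ⁻¹' {x}) =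
      ∑ x : α × β × γ, μ.real ((fun ω => (A ω, C ω)) ⁻¹' {(x.1, x.2.2)}) *
        μ.real ((fun ω => (B ω, C ω)) ⁻¹' {x.2}) / μ.real (C ⁻¹' {x.2.2}) := by
    have hl : ∑ x : α × β × γ, μ.real ((fun ω => (A ω, B ω, C ω)) ⁻¹' {x}) =
        ∑ c, μ.real (C ⁻¹' {c}) := by
      rw [Fintype.sum_prod_type_right]
      simp only [sum_measureReal_prodMk_preimage_singleton hA (hB.prodMk hC)]
      rw [Fintype.sum_prod_type_right]
      simp only [sum_measureReal_prodMk_preimage_singleton hB hC]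
    rw [hl, Fintype.sum_prod_type_right, Fintype.sum_prod_type_right]
    refine Finset.sum_congr rfl fun c _ => ?_
    simp only [← Finset.sum_div, ← Finset.sum_mul, ← Finset.mul_sum,
      sum_measureReal_prodMk_preimage_singleton hA hC,
      sum_measureReal_prodMk_preimage_singleton hB hC]
    exact (mul_self_div_self _).symm
  have hle := Finset.sum_le_sum fun (x : α × β × γ) (_ : x ∈ Finset.univ) =>
    sub_le_mul_log_sub_log (p := μ.real ((fun ω => (A ω, B ω, C ω)) ⁻¹' {x}))
      (q := μ.real ((fun ω => (A ω, C ω)) ⁻¹' {(x.1, x.2.2)}))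
      (r := μ.real ((fun ω => (B ω, C ω)) ⁻¹' {x.2}))
      (s := μ.real (C ⁻¹' {x.2.2})) measureReal_nonneg
      (measureReal_mono (by rintro ω rfl; rfl))
      (measureReal_mono (by rintro ω rfl; rfl))
      (measureReal_mono fun ω hω => congrArg Prod.snd hω)
  rw [Finset.sum_sub_distrib, ← hsum, sub_self] at hle
  simp only [mul_sub, mul_add, Finset.sum_sub_distrib, Finset.sum_add_distrib] at hle
  linarith

end Entropy

/-- Sufficiency lemma: if `Z' = f ∘ X'` is a deterministic encoding of `X'`,
`Y → X → X'` is a Markov chain (`I(X' : Y | X) = 0`), and `Z'` retains all the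
information `X'` carries about `X` (`I(Z' : X) = I(X' : X)`), then
`I(Z' : Y) = I(X' : Y)`. -/
theorem sufficiency_preserves_task_info
    {Ω α α' β γ : Type*} [MeasurableSpace Ω]
    [Fintype α] [MeasurableSpace α] [MeasurableSingletonClass α]
    [Fintype α'] [MeasurableSpace α'] [MeasurableSingletonClass α']
    [Fintype β] [MeasurableSpace β] [MeasurableSingletonClass β]
    [Fintype γ] [MeasurableSpace γ] [MeasurableSingletonClass γ]
    (μ : Measure Ω) [IsProbabilityMeasure μ]
    (X : Ω → α) (X' : Ω → α') (Y : Ω → γ) (Z' : Ω → β)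
    (hX : Measurable X) (hX' : Measurable X') (hY : Measurable Y)
    (f : α' → β) (hZ' : Z' = f ∘ X')
    (hmarkov : condMutInfo μ X' Y X = 0)
    (hsuff : mutInfo μ Z' X = mutInfo μ X' X) :
    mutInfo μ Z' Y = mutInfo μ X' Y := by
  have hf : Measurable f := measurable_of_finite f
  have hZ : Measurable Z' := hZ' ▸ hf.comp hX'
  have hWZ : shEntropy μ (fun ω => (X' ω, Z' ω)) = shEntropy μ X' := by
    subst hZ'
    exact shEntropy_comp_of_injective (g := fun w => (w, f w)) hX'
      fun a b h => congrArg Prod.fst h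
  have hWYZ : shEntropy μ (fun ω => (X' ω, Y ω, Z' ω)) = shEntropy μ (fun ω => (X' ω, Y ω)) := by
    subst hZ'
    exact shEntropy_comp_of_injective (g := fun x : α' × γ => (x.1, x.2, f x.1))
      (hX'.prodMk hY) fun a b h => by simp_all [Prod.ext_iff]
  have hWXYZ : shEntropy μ (fun ω => (X' ω, X ω, Y ω, Z' ω)) =
      shEntropy μ (fun ω => (X' ω, Y ω, X ω)) := by
    subst hZ'
    exact shEntropy_comp_of_injective
      (g := fun x : α' × γ × α => (x.1, x.2.2, x.2.1, f x.1))
      (hX'.prodMk (hY.prodMk hX)) fun a b h => by simp_all [Prod.ext_iff]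
  have hYZ : shEntropy μ (fun ω => (Y ω, Z' ω)) = shEntropy μ (fun ω => (Z' ω, Y ω)) :=
    shEntropy_comp_of_injective (hZ.prodMk hY) Prod.swap_injective
  have hXYZ : shEntropy μ (fun ω => (X ω, Y ω, Z' ω)) =
      shEntropy μ (fun ω => (Z' ω, Y ω, X ω)) :=
    shEntropy_comp_of_injective (g := fun x : β × γ × α => (x.2.2, x.2.1, x.1))
      (hZ.prodMk (hY.prodMk hX)) fun a b h => by simp_all [Prod.ext_iff]
  have h₁ := condMutInfo_nonneg (μ := μ) hX' hY hZ
  have h₂ := condMutInfo_nonneg (μ := μ) hX' hX (hY.prodMk hZ)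
  have h₃ := condMutInfo_nonneg (μ := μ) hZ hY hX
  simp only [condMutInfo, mutInfo] at *
  linarith
end

section
/- Lemma 3 (optimal representations preserve task information): let X and Y be random variables with values in finite sets, let X' = t(X) for a (deterministic) function t with values in the same set as X, and let f* be a function such that I(f* ∘ X : f* ∘ X') = I(X : X') (i.e. f* maximizes the mutual information between the encodings of X and its augmentation). Then, writing Z' = f* ∘ X', one has I(Z' : Y) = I(X' : Y): the optimal representation of the transformed input retains exactly the task-relevant information of X'. -/
open MeasureTheory ProbabilityTheory Real

theorem preimage_comp_singleton_measurable {Ω α β : Type*} [MeasurableSpace Ω] [Finite α]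
    {A : Ω → α} (hA : ∀ a, MeasurableSet (A ⁻¹' {a})) (g : α → β) (b : β) :
    MeasurableSet ((g ∘ A) ⁻¹' {b}) := by
  have h : (g ∘ A) ⁻¹' {b} = ⋃ a ∈ g ⁻¹' {b}, A ⁻¹' {a} := by ext; simp
  rw [h]
  exact (Set.toFinite _).measurableSet_biUnion fun a _ => hA a

theorem preimage_prodMk_singleton {Ω α γ : Type*} (A : Ω → α) (Y : Ω → γ) (a : α) (y : γ) :
    (fun ω => (A ω, Y ω)) ⁻¹' {(a, y)} = A ⁻¹' {a} ∩ Y ⁻¹' {y} := by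
  ext; simp

theorem preimage_singleton_subset_comp {Ω α β : Type*} (A : Ω → α) (g : α → β) (a : α) :
    A ⁻¹' {a} ⊆ (g ∘ A) ⁻¹' {g a} := by
  rintro ω rfl
  rfl

section Entropy

variable {Ω α β γ : Type*} [MeasurableSpace Ω] (μ : Measure Ω) [IsFiniteMeasure μ] {A : Ω → α}

theorem measureReal_mul_log_sub_log_nonneg (g : α → β) (a : α) : 0 ≤ μ.real (A ⁻¹' {a}) *
    (log (μ.real ((g ∘ A) ⁻¹' {g a})) - log (μ.real (A ⁻¹' {a}))) := by
  rcases (measureReal_nonneg (μ := μ) (s := A ⁻¹' {a})).eq_or_lt with h | h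
  · simp [← h]
  · exact mul_nonneg h.le <| sub_nonneg.mpr <|
      log_le_log h (measureReal_mono (preimage_singleton_subset_comp A g a))

variable [Fintype α]

open Classical in
theorem measureReal_comp_singleton (hA : ∀ a, MeasurableSet (A ⁻¹' {a})) (g : α → β) (b : β) :
    μ.real ((g ∘ A) ⁻¹' {b}) = ∑ a with g a = b, μ.real (A ⁻¹' {a}) := by
  have h : (g ∘ A) ⁻¹' {b} = ⋃ a ∈ Finset.univ.filter (g · = b), A ⁻¹' {a} := by ext; simp
  rw [h, measureReal_biUnion_finset _ fun a _ => hA a]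
  intro a _ a' _ haa'
  exact Disjoint.preimage A (by simpa using haa')

variable [Fintype β] [Fintype γ]

/-- The entropy lost by a function of a random variable, as a sum over the atoms. -/
theorem shEntropy_sub_shEntropy_comp (hA : ∀ a, MeasurableSet (A ⁻¹' {a})) (g : α → β) :
    shEntropy μ A - shEntropy μ (g ∘ A) = ∑ a, μ.real (A ⁻¹' {a}) *
      (log (μ.real ((g ∘ A) ⁻¹' {g a})) - log (μ.real (A ⁻¹' {a}))) := by
  classical
  have h : ∑ b, μ.real ((g ∘ A) ⁻¹' {b}) * log (μ.real ((g ∘ A) ⁻¹' {b})) =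
      ∑ a, μ.real (A ⁻¹' {a}) * log (μ.real ((g ∘ A) ⁻¹' {g a})) := by
    rw [← Finset.sum_fiberwise Finset.univ g]
    refine Finset.sum_congr rfl fun b _ => ?_
    conv_lhs => rw [measureReal_comp_singleton μ hA g b, Finset.sum_mul]
    refine Finset.sum_congr rfl fun a ha => ?_
    rw [(Finset.mem_filter.mp ha).2, measureReal_comp_singleton μ hA g b]
  simp only [shEntropy, ← measureReal_def]
  rw [h]
  simp only [mul_sub, Finset.sum_sub_distrib]
  ring

theorem shEntropy_comp_le (hA : ∀ a, MeasurableSet (A ⁻¹' {a})) (g : α → β) :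
    shEntropy μ (g ∘ A) ≤ shEntropy μ A := by
  rw [← sub_nonneg, shEntropy_sub_shEntropy_comp μ hA g]
  exact Finset.sum_nonneg fun a _ => measureReal_mul_log_sub_log_nonneg μ g a

/-- A function of a random variable loses no entropy iff it merges no atoms of positive mass. -/
theorem shEntropy_comp_eq_iff (hA : ∀ a, MeasurableSet (A ⁻¹' {a})) (g : α → β) :
    shEntropy μ (g ∘ A) = shEntropy μ A ↔
      ∀ a, μ.real (A ⁻¹' {a}) = 0 ∨ μ.real ((g ∘ A) ⁻¹' {g a}) = μ.real (A ⁻¹' {a}) := by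
  rw [eq_comm, ← sub_eq_zero, shEntropy_sub_shEntropy_comp μ hA g,
    Finset.sum_eq_zero_iff_of_nonneg fun a _ => measureReal_mul_log_sub_log_nonneg μ g a]
  refine forall_congr' fun a => ?_
  simp only [Finset.mem_univ, true_imp_iff, mul_eq_zero, sub_eq_zero]
  refine or_congr_right' fun h => ?_
  have hpos : 0 < μ.real (A ⁻¹' {a}) := lt_of_le_of_ne measureReal_nonneg (Ne.symm h)
  have hle := measureReal_mono (μ := μ) (preimage_singleton_subset_comp A g a)
  exact log_injOn_pos.eq_iff (hpos.trans_le hle) hpos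

theorem shEntropy_comp_of_injective_s9 (hA : ∀ a, MeasurableSet (A ⁻¹' {a})) {g : α → β}
    (hg : g.Injective) : shEntropy μ (g ∘ A) = shEntropy μ A := by
  refine (shEntropy_comp_eq_iff μ hA g).mpr fun a => Or.inr ?_
  congr 1
  ext ω
  simp [hg.eq_iff]

theorem shEntropy_prodMk_comp_eq {Y : Ω → γ} (hA : ∀ a, MeasurableSet (A ⁻¹' {a}))
    (hY : ∀ y, MeasurableSet (Y ⁻¹' {y})) {g : α → β}
    (h : shEntropy μ (g ∘ A) = shEntropy μ A) :
    shEntropy μ (fun ω => ((g ∘ A) ω, Y ω)) = shEntropy μ (fun ω => (A ω, Y ω)) := by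
  have hAY : ∀ p : α × γ, MeasurableSet ((fun ω => (A ω, Y ω)) ⁻¹' {p}) := fun p => by
    rw [preimage_prodMk_singleton]
    exact (hA p.1).inter (hY p.2)
  refine (shEntropy_comp_eq_iff μ hAY (Prod.map g id)).mpr fun ⟨a, y⟩ => ?_
  change _ ∨ μ.real ((fun ω => ((g ∘ A) ω, Y ω)) ⁻¹' {(g a, y)}) = _
  simp only [preimage_prodMk_singleton]
  refine ((shEntropy_comp_eq_iff μ hA g).mp h a).imp (fun h0 => ?_) fun h1 => ?_
  · exact measureReal_mono_null Set.inter_subset_left h0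
  · have hae : A ⁻¹' {a} =ᵐ[μ] (g ∘ A) ⁻¹' {g a} :=
      ae_eq_of_subset_of_measure_ge (preimage_singleton_subset_comp A g a)
        ((measureReal_eq_measureReal_iff).mp h1).le (hA a).nullMeasurableSet (measure_ne_top _ _)
    exact (measureReal_congr (hae.inter (ae_eq_refl _))).symm

end Entropy

/-- Lemma 3 (optimal representations preserve task information): if `X' = t ∘ X` is a
deterministic transformation of `X` and `f⋆` is an optimal encoder, i.e.
`I(f⋆ ∘ X : f⋆ ∘ X') = I(X : X')`, then the representation `Z' = f⋆ ∘ X'` satisfies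
`I(Z' : Y) = I(X' : Y)`. -/
theorem optimal_representation_preserves_task_info
    {Ω 𝒳 β γ : Type*} [MeasurableSpace Ω]
    [Fintype 𝒳] [MeasurableSpace 𝒳] [MeasurableSingletonClass 𝒳]
    [Fintype β] [MeasurableSpace β] [MeasurableSingletonClass β]
    [Fintype γ] [MeasurableSpace γ] [MeasurableSingletonClass γ]
    (μ : Measure Ω) [IsProbabilityMeasure μ]
    (X : Ω → 𝒳) (Y : Ω → γ)
    (hX : Measurable X) (hY : Measurable Y)
    (t : 𝒳 → 𝒳) (fstar : 𝒳 → β)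
    (hopt : mutInfo μ (fstar ∘ X) (fstar ∘ (t ∘ X)) = mutInfo μ X (t ∘ X)) :
    mutInfo μ (fstar ∘ (t ∘ X)) Y = mutInfo μ (t ∘ X) Y := by
  have mX : ∀ a, MeasurableSet (X ⁻¹' {a}) := fun a => hX (measurableSet_singleton a)
  have mY : ∀ y, MeasurableSet (Y ⁻¹' {y}) := fun y => hY (measurableSet_singleton y)
  have mX' := preimage_comp_singleton_measurable mX t
  have hXX' : shEntropy μ (fun ω => (X ω, (t ∘ X) ω)) = shEntropy μ X :=
    shEntropy_comp_of_injective_s9 μ mX (g := fun a => (a, t a)) fun _ _ h => congrArg Prod.fst h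
  have hZZ' : shEntropy μ (fstar ∘ X) ≤
      shEntropy μ (fun ω => ((fstar ∘ X) ω, (fstar ∘ (t ∘ X)) ω)) :=
    shEntropy_comp_le μ
      (preimage_comp_singleton_measurable mX fun a => (fstar a, fstar (t a))) Prod.fst
  have hle := shEntropy_comp_le μ mX' fstar
  simp only [mutInfo] at hopt ⊢
  have heq : shEntropy μ (fstar ∘ (t ∘ X)) = shEntropy μ (t ∘ X) := by linarith
  rw [heq, shEntropy_prodMk_comp_eq μ mX' mY heq]
end
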